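/- Let x ~ N(0, I_d) be a standard Gaussian in ℝ^d, θ ∈ ℝ^d fixed, β(z) = σ(z)σ(−z) the logistic variance, and ε > 0. Then E[β((1+ε)⟨x,θ⟩) x xᵀ] ⪯ (1 − c·min(ε,1)) · E[β(⟨x,θ⟩) x xᵀ] for some absolute constant c > 0 (depending on ‖θ‖₂ being bounded above and below by constants). -/

import Mathlib

open MeasureTheory ProbabilityTheory

/-- The logistic variance function `β(z) = σ(z)σ(−z) = e^z/(1+e^z)²`. -/
noncomputable def logisticVar (z : ℝ) : ℝ := Real.exp z / (1 + Real.exp z) ^ 2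

/-- The standard Gaussian measure on `ℝ^d`. -/
noncomputable def stdGaussian (d : ℕ) : Measure (Fin d → ℝ) :=
  Measure.pi fun _ => gaussianReal 0 1

lemma logisticVar_eq (z : ℝ) : logisticVar z = 1 / (2 * (1 + Real.cosh z)) := by
  unfold logisticVar
  rw [Real.cosh_eq, Real.exp_neg]
  have := Real.exp_pos z
  field_simp
  ring

lemma logisticVar_nonneg (z : ℝ) : 0 ≤ logisticVar z := by
  unfold logisticVar; positivity

lemma logisticVar_le (z : ℝ) : logisticVar z ≤ 1 / 4 := by
  rw [logisticVar_eq]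
  have := Real.one_le_cosh z
  apply one_div_le_one_div_of_le <;> linarith

lemma logisticVar_cont : Continuous logisticVar := by
  unfold logisticVar
  have : ∀ z, (1 + Real.exp z)^2 ≠ 0 := fun z => by positivity
  fun_prop (disch := assumption)

lemma logisticVar_anti {a b : ℝ} (h : |a| ≤ |b|) : logisticVar b ≤ logisticVar a := by
  rw [logisticVar_eq, logisticVar_eq]
  have := Real.one_le_cosh a
  have := Real.cosh_le_cosh.2 h
  apply one_div_le_one_div_of_le <;> linarith

lemma delta_nonneg (z ε : ℝ) (hε : 0 < ε) : logisticVar ((1+ε)*z) ≤ logisticVar z := by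
  apply logisticVar_anti
  rw [abs_mul, abs_of_pos (by linarith : 0 < 1 + ε)]
  nlinarith [abs_nonneg z]

lemma delta_lower (M z ε : ℝ) (hε : 0 < ε) (hz : 1 ≤ z) (hM : z ≤ M) :
    (min ε 1) * (1 / (2 * (1 + Real.cosh (2*M))^2)) ≤ logisticVar z - logisticVar ((1+ε)*z) := by
  set m := min ε 1 with hm
  have m0 : 0 < m := lt_min hε one_pos
  have m1 : m ≤ 1 := min_le_right _ _
  have me : m ≤ ε := min_le_left _ _
  have h1 : logisticVar ((1+ε)*z) ≤ logisticVar ((1+m)*z) := by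
    apply logisticVar_anti
    rw [abs_of_nonneg (by positivity), abs_of_nonneg (by positivity)]
    gcongr
  have h2 : Real.cosh z + m ≤ Real.cosh ((1+m)*z) := by
    rw [show (1+m)*z = z + m*z by ring, Real.cosh_add]
    have a1 := Real.one_le_cosh z
    have a2 := Real.one_le_cosh (m*z)
    have a3 : z ≤ Real.sinh z := Real.self_le_sinh_iff.2 (by linarith)
    have a4 : m*z ≤ Real.sinh (m*z) := Real.self_le_sinh_iff.2 (by positivity)
    have : m ≤ Real.sinh (m*z) := by nlinarith
    nlinarith
  have h3 : Real.cosh ((1+m)*z) ≤ Real.cosh (2*M) := by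
    rw [Real.cosh_le_cosh, abs_of_nonneg (by positivity), abs_of_nonneg (by linarith)]
    nlinarith
  refine le_trans ?_ (sub_le_sub_left h1 _)
  rw [logisticVar_eq, logisticVar_eq]
  generalize Real.cosh ((1+m)*z) = b at *
  have a1 := Real.one_le_cosh z
  generalize Real.cosh z = a at *
  generalize Real.cosh (2*M) = k at *
  have : 1 / (2 * (1 + a)) - 1 / (2 * (1 + b)) = (b - a) * (1 / (2 * ((1+a) * (1+b)))) := by
    have : 1 + a ≠ 0 := by linarith
    have : 1 + b ≠ 0 := by linarith
    field_simp
    ring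
  rw [this, sq]
  have : 0 < 1 + a := by linarith
  have : 0 < 1 + b := by linarith
  have hk : 0 < 1 + k := by linarith
  have : m ≤ b - a := by linarith
  have : a ≤ k := by linarith
  have : 0 ≤ b - a := by linarith
  gcongr

section G
variable {d : ℕ}

local notation "P" => (Measure.pi fun _ : Fin d => gaussianReal 0 1)

lemma gl_id : HasGaussianLaw (fun x : Fin d → ℝ => x) P := by
  have h : iIndepFun (fun i (x : Fin d → ℝ) => x i) P :=
    iIndepFun_pi (X := fun _ ↦ id) (fun _ ↦ aemeasurable_id)
  refine h.hasGaussianLaw fun i => ?_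
  have := (measurePreserving_eval (fun _ : Fin d => gaussianReal 0 1) i).hasLaw
  exact this.hasGaussianLaw

lemma gl_pair (u w : Fin d → ℝ) :
    HasGaussianLaw (fun x : Fin d → ℝ => (∑ l, x l * u l, ∑ l, x l * w l)) P := by
  have := (gl_id (d := d)).map_fun
    ((∑ l, (u l) • ContinuousLinearMap.proj (R := ℝ) (φ := fun _ : Fin d => ℝ) l).prod
     (∑ l, (w l) • ContinuousLinearMap.proj (R := ℝ) (φ := fun _ : Fin d => ℝ) l))
  simpa [mul_comm] using this

lemma gl_coord (i : Fin d) : HasGaussianLaw (fun x : Fin d → ℝ => x i) P := 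
  ((measurePreserving_eval (fun _ : Fin d => gaussianReal 0 1) i).hasLaw).hasGaussianLaw

lemma mean_coord (i : Fin d) : ∫ x, x i ∂P = 0 := by
  have := ((measurePreserving_eval (fun _ : Fin d => gaussianReal 0 1) i).hasLaw).integral_eq
  simpa using this

lemma mean_lin (u : Fin d → ℝ) : ∫ x, ∑ l, x l * u l ∂P = 0 := by
  rw [integral_finsetSum]
  · simp [integral_mul_const, mean_coord]
  · intro i _
    exact (gl_coord i).integrable.mul_const _

lemma cov_coord (i j : Fin d) : cov[fun x : Fin d → ℝ => x i, fun x => x j; P] = if i = j then 1 else 0 := by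
  have h : iIndepFun (fun i (x : Fin d → ℝ) => x i) P :=
    iIndepFun_pi (X := fun _ ↦ id) (fun _ ↦ aemeasurable_id)
  split_ifs with hij
  · subst hij
    rw [covariance_self (gl_coord i).aemeasurable]
    have := ((measurePreserving_eval (fun _ : Fin d => gaussianReal 0 1) i).hasLaw).variance_eq
    simpa [variance_id_gaussianReal] using this
  · exact (h.indepFun hij).covariance_eq_zero (gl_coord i).memLp_two (gl_coord j).memLp_two

lemma cov_lin (u w : Fin d → ℝ) :
    cov[fun x : Fin d → ℝ => ∑ l, x l * u l, fun x => ∑ l, x l * w l; P] = ∑ l, u l * w l := by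
  rw [covariance_fun_sum_fun_sum]
  · simp [covariance_mul_const_left, covariance_mul_const_right, cov_coord]
  · intro i; exact (gl_coord i).memLp_two.mul_const _
  · intro i; exact (gl_coord i).memLp_two.mul_const _

lemma map_lin (u : Fin d → ℝ) (hu : ∑ l, u l * u l = 1) :
    (P).map (fun x : Fin d → ℝ => ∑ l, x l * u l) = gaussianReal 0 1 := by
  have := (gl_pair u u).fst.map_eq_gaussianReal
  rw [this, ← covariance_self (gl_pair u u).fst.aemeasurable, cov_lin, mean_lin, hu]
  simp

lemma psd_of (h : ℝ → ℝ) (hc : Continuous h) (K : ℝ) (hK : ∀ t, |h t| ≤ K) (r : ℝ) (u : Fin d → ℝ)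
    (hu : ∑ l, u l * u l = 1)
    (h0 : 0 ≤ ∫ g, h (r * g) ∂(gaussianReal 0 1))
    (h2 : 0 ≤ ∫ g, h (r * g) * g^2 ∂(gaussianReal 0 1)) (v : Fin d → ℝ) :
    0 ≤ ∫ x, h (r * ∑ l, x l * u l) * (∑ l, x l * v l)^2 ∂P := by
  set a := ∑ l, u l * v l with ha
  set w : Fin d → ℝ := fun l => v l - a * u l with hw
  have huw : ∑ l, u l * w l = 0 := by
    simp only [hw, mul_sub, Finset.sum_sub_distrib]
    rw [← ha]
    simp_rw [mul_left_comm _ a, ← Finset.mul_sum, hu]; ring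
  set X : (Fin d → ℝ) → ℝ := fun x => ∑ l, x l * u l with hX
  set Y : (Fin d → ℝ) → ℝ := fun x => ∑ l, x l * w l with hY
  have hg := gl_pair u w
  have hXm : Measurable X := by fun_prop
  have hYm : Measurable Y := by fun_prop
  have hI : IndepFun X Y P := hg.indepFun_of_covariance_eq_zero (by rw [cov_lin, huw])
  have hX2 : MemLp X 2 P := hg.fst.memLp_two
  have hY2 : MemLp Y 2 P := hg.snd.memLp_two
  have hv : ∀ x : Fin d → ℝ, ∑ l, x l * v l = a * X x + Y x := by
    intro x
    simp only [hX, hY, hw, Finset.mul_sum, ← Finset.sum_add_distrib]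
    exact Finset.sum_congr rfl fun l _ => by ring
  have bd : ∀ F : (Fin d → ℝ) → ℝ, Integrable F P → Integrable (fun x => h (r * X x) * F x) P := by
    intro F hF
    exact hF.bdd_mul (c := K) (by fun_prop) (ae_of_all _ fun x => hK _)
  have i1 := bd _ hX2.integrable_sq
  have i2 := bd _ (hX2.integrable_mul hY2)
  have i3 := bd _ hY2.integrable_sq
  have e1 : ∫ x, h (r * X x) * X x ^ 2 ∂P = ∫ g, h (r * g) * g^2 ∂(gaussianReal 0 1) := by
    rw [← integral_map (φ := X) (f := fun g => h (r * g) * g^2) hXm.aemeasurable (by fun_prop), map_lin u hu]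
  have e0 : ∫ x, h (r * X x) ∂P = ∫ g, h (r * g) ∂(gaussianReal 0 1) := by
    rw [← integral_map (φ := X) (f := fun g => h (r * g)) hXm.aemeasurable (by fun_prop), map_lin u hu]
  have e2 : ∫ x, h (r * X x) * (X x * Y x) ∂P = 0 := by
    have I2 : IndepFun (fun x => h (r * X x) * X x) Y P :=
      hI.comp (φ := fun t => h (r * t) * t) (ψ := id) (by fun_prop) measurable_id
    have := I2.integral_fun_mul_eq_mul_integral (by fun_prop) (by fun_prop)
    simp_rw [← mul_assoc]
    rw [this, mean_lin, mul_zero]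
  have e3 : ∫ x, h (r * X x) * (Y x)^2 ∂P = (∫ x, h (r * X x) ∂P) * ∫ x, (Y x)^2 ∂P := by
    have I2 : IndepFun (fun x => h (r * X x)) (fun x => Y x ^ 2) P :=
      hI.comp (φ := fun t => h (r * t)) (ψ := fun t => t^2) (by fun_prop) (by fun_prop)
    exact I2.integral_fun_mul_eq_mul_integral (by fun_prop) (by fun_prop)
  have : ∀ x, h (r * X x) * (∑ l, x l * v l)^2 = a^2 * (h (r * X x) * X x ^2) + (2*a) * (h (r * X x) * (X x * Y x)) + h (r * X x) * (Y x)^2 := by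
    intro x; rw [hv]; ring
  change 0 ≤ ∫ x, h (r * X x) * (∑ l, x l * v l)^2 ∂P
  simp_rw [this]
  rw [integral_add, integral_add, integral_const_mul, integral_const_mul, e1, e2, e3, e0]
  · have : 0 ≤ ∫ x, (Y x)^2 ∂P := integral_nonneg fun x => sq_nonneg _
    have := mul_nonneg h0 this
    have := mul_nonneg (sq_nonneg a) h2
    linarith
  · exact i1.const_mul _
  · exact i2.const_mul _
  · exact (i1.const_mul _).add (i2.const_mul _)
  · exact i3

lemma matrix_psd (h : ℝ → ℝ) (hc : Continuous h) (K : ℝ) (hK : ∀ t, |h t| ≤ K) (θ : Fin d → ℝ)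
    (hθ : 0 < Real.sqrt (∑ i, θ i ^ 2))
    (h0 : 0 ≤ ∫ g, h (Real.sqrt (∑ i, θ i ^ 2) * g) ∂(gaussianReal 0 1))
    (h2 : 0 ≤ ∫ g, h (Real.sqrt (∑ i, θ i ^ 2) * g) * g^2 ∂(gaussianReal 0 1)) :
    Matrix.PosSemidef (Matrix.of fun i j => ∫ x, h (∑ l, x l * θ l) * x i * x j ∂P) := by
  set r := Real.sqrt (∑ i, θ i ^ 2) with hr
  have hr2 : r ^ 2 = ∑ i, θ i ^ 2 := Real.sq_sqrt (by positivity)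
  set u : Fin d → ℝ := fun i => θ i / r with hu
  have huu : ∑ l, u l * u l = 1 := by
    have : ∀ l, u l * u l = θ l ^ 2 / r ^ 2 := fun l => by simp only [hu]; field_simp
    simp_rw [this, ← Finset.sum_div, ← hr2]
    field_simp
  have hxu : ∀ x : Fin d → ℝ, ∑ l, x l * θ l = r * ∑ l, x l * u l := by
    intro x
    rw [Finset.mul_sum]
    refine Finset.sum_congr rfl fun l _ => ?_
    simp only [hu]; field_simp
  have hint : ∀ i j, Integrable (fun x : Fin d → ℝ => h (∑ l, x l * θ l) * x i * x j) P := by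
    intro i j
    simp_rw [mul_assoc]
    refine Integrable.bdd_mul (c := K) ((gl_coord i).memLp_two.integrable_mul (gl_coord j).memLp_two) ?_
      (ae_of_all _ fun x => hK _)
    have : Continuous fun x : Fin d → ℝ => h (∑ l, x l * θ l) := by fun_prop
    exact this.aestronglyMeasurable
  refine Matrix.PosSemidef.of_dotProduct_mulVec_nonneg ?_ fun v => ?_
  · ext i j
    simp only [Matrix.conjTranspose_apply, Matrix.of_apply, star_trivial]
    congr 1; ext x; ring
  · have key := psd_of h hc K hK r u huu h0 h2 v
    have e : ∀ x : Fin d → ℝ, h (r * ∑ l, x l * u l) * (∑ l, x l * v l)^2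
        = ∑ i, ∑ j, v i * ((h (∑ l, x l * θ l) * x i * x j) * v j) := by
      intro x
      rw [← hxu, sq, Finset.sum_mul_sum, Finset.mul_sum]
      refine Finset.sum_congr rfl fun i _ => ?_
      rw [Finset.mul_sum]
      exact Finset.sum_congr rfl fun j _ => by ring
    simp_rw [e] at key
    rw [integral_finsetSum _ fun i _ => integrable_finsetSum _ fun j _ =>
      ((hint i j).mul_const _).const_mul _] at key
    simp only [dotProduct, Matrix.mulVec, Matrix.of_apply, star_trivial, Pi.star_apply]
    refine key.trans_eq (Finset.sum_congr rfl fun i _ => ?_)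
    rw [integral_finsetSum _ fun j _ => ((hint i j).mul_const _).const_mul _, Finset.mul_sum]
    exact Finset.sum_congr rfl fun j _ => by rw [integral_const_mul, integral_mul_const]
end G

lemma one_dim (M r s t ε κ c : ℝ) (hε : 0 < ε) (q : ℝ → ℝ)
    (qc : Continuous q) (q0 : ∀ g, 0 ≤ q g) (qi : Integrable q (gaussianReal 0 1))
    (q1 : ∫ g, q g ∂(gaussianReal 0 1) ≤ 1) (hκ : 0 ≤ κ) (hq : ∀ g ∈ Set.Icc s t, κ ≤ q g)
    (hr : ∀ g ∈ Set.Icc s t, 1 ≤ r * g ∧ r * g ≤ M) (c0 : 0 ≤ c)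
    (hc : c ≤ 4 * ((1 / (2 * (1 + Real.cosh (2*M))^2)) * (gaussianReal 0 1).real (Set.Icc s t) * κ)) :
    0 ≤ ∫ g, ((1 - c * min ε 1) * logisticVar (r * g) - logisticVar ((1 + ε) * (r * g))) * q g
      ∂(gaussianReal 0 1) := by
  set D := 1 / (2 * (1 + Real.cosh (2*M))^2)
  have D0 : 0 ≤ D := by positivity
  set m := min ε 1 with hm
  have m0 : 0 < m := lt_min hε one_pos
  have lc := logisticVar_cont
  have bb : ∀ z, ‖logisticVar z‖ ≤ 1/4 := fun z => by
    rw [Real.norm_of_nonneg (logisticVar_nonneg z)]; exact logisticVar_le z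
  have i1 : Integrable (fun g => logisticVar (r * g) * q g) (gaussianReal 0 1) :=
    qi.bdd_mul (c := 1/4) (by fun_prop) (ae_of_all _ fun x => bb _)
  have i2 : Integrable (fun g => logisticVar ((1 + ε) * (r * g)) * q g) (gaussianReal 0 1) :=
    qi.bdd_mul (c := 1/4) (by fun_prop) (ae_of_all _ fun x => bb _)
  have i3 : Integrable (fun g => (logisticVar (r * g) - logisticVar ((1 + ε) * (r * g))) * q g)
      (gaussianReal 0 1) := by
    simp_rw [sub_mul]; exact i1.sub i2
  have e : ∀ g, ((1 - c * m) * logisticVar (r * g) - logisticVar ((1 + ε) * (r * g))) * q g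
      = (logisticVar (r * g) - logisticVar ((1 + ε) * (r * g))) * q g
        - (c * m) * (logisticVar (r * g) * q g) := fun g => by ring
  simp_rw [e]
  rw [integral_sub i3 (i1.const_mul _), integral_const_mul]
  have u1 : ∫ g, logisticVar (r * g) * q g ∂(gaussianReal 0 1) ≤ 1/4 := by
    calc _ ≤ ∫ g, 1/4 * q g ∂(gaussianReal 0 1) :=
          integral_mono i1 (qi.const_mul _) fun g =>
            mul_le_mul_of_nonneg_right (logisticVar_le _) (q0 g)
      _ ≤ 1/4 := by rw [integral_const_mul]; linarith
  have u2 := setIntegral_le_integral (s := Set.Icc s t) i3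
    (ae_of_all _ fun g => mul_nonneg (sub_nonneg.2 (delta_nonneg _ ε hε)) (q0 g))
  have u3 := setIntegral_ge_of_const_le (μ := gaussianReal 0 1) (c := m * D * κ)
    (measurableSet_Icc (a := s) (b := t)) (measure_ne_top _ _) (fun g hg => mul_le_mul
      (delta_lower M (r*g) ε hε (hr g hg).1 (hr g hg).2) (hq g hg) hκ
      (sub_nonneg.2 (delta_nonneg _ ε hε))) i3.integrableOn
  rw [smul_eq_mul] at u3
  have u4 : c * m * ∫ g, logisticVar (r * g) * q g ∂(gaussianReal 0 1) ≤ c * m * (1/4) :=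
    mul_le_mul_of_nonneg_left u1 (by positivity)
  have u5 := mul_le_mul_of_nonneg_right hc m0.le
  linarith

/-- Scaling up the parameter strictly shrinks the expected logistic Hessian:
for `x ∼ N(0, I_d)` and `c₀ ≤ ‖θ‖₂ ≤ C₀`, there is an absolute constant `c > 0`
(depending only on `c₀, C₀`) with
`E[β((1+ε)⟨x,θ⟩) x xᵀ] ⪯ (1 − c·min(ε,1)) · E[β(⟨x,θ⟩) x xᵀ]`. -/
theorem expected_hessian_decreases_along_theta (c₀ C₀ : ℝ) (h₀ : 0 < c₀) (h₁ : c₀ ≤ C₀) :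
    ∃ c > (0 : ℝ), ∀ (d : ℕ) (θ : Fin d → ℝ) (ε : ℝ), 0 < ε →
      c₀ ≤ Real.sqrt (∑ i, θ i ^ 2) → Real.sqrt (∑ i, θ i ^ 2) ≤ C₀ →
      Matrix.PosSemidef
        ((1 - c * min ε 1) •
            (Matrix.of fun i j =>
              ∫ x, logisticVar (∑ l, x l * θ l) * x i * x j ∂(stdGaussian d))
          - Matrix.of fun i j =>
              ∫ x, logisticVar ((1 + ε) * ∑ l, x l * θ l) * x i * x j ∂(stdGaussian d)) := by
  have hp : 0 < (gaussianReal 0 1).real (Set.Icc (1/c₀) (1/c₀+1)) := by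
    rw [measureReal_def, ENNReal.toReal_pos_iff]
    refine ⟨?_, measure_lt_top _ _⟩
    rw [pos_iff_ne_zero]
    intro h
    have := gaussianReal_absolutelyContinuous' 0 one_ne_zero h
    simp at this
  set p := (gaussianReal 0 1).real (Set.Icc (1/c₀) (1/c₀+1)) with hpd
  set M := C₀ * (1/c₀+1) with hM
  have hC : 0 < C₀ := by linarith
  set D := 1 / (2 * (1 + Real.cosh (2*M))^2) with hD
  have D0 : 0 < D := by
    have := Real.cosh_pos (2*M)
    positivity
  have k0 : 0 < min 1 ((1/c₀)^2) := lt_min one_pos (by positivity)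
  set c := 4 * (D * p * min 1 ((1/c₀)^2)) with hcd
  have c0 : 0 < c := by positivity
  refine ⟨c, c0, ?_⟩
  intro d θ ε hε hl hu
  set h : ℝ → ℝ := fun t => (1 - c * min ε 1) * logisticVar t - logisticVar ((1 + ε) * t) with hh
  have lc := logisticVar_cont
  have hr : ∀ g ∈ Set.Icc (1/c₀) (1/c₀+1), 1 ≤ Real.sqrt (∑ i, θ i ^ 2) * g ∧
      Real.sqrt (∑ i, θ i ^ 2) * g ≤ M := by
    rintro g ⟨g1, g2⟩
    have hc1 : c₀ * (1/c₀) = 1 := by field_simp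
    have : 0 < 1/c₀ := by positivity
    have : 0 ≤ g := by linarith
    constructor
    · rw [← hc1]; gcongr
    · rw [hM]; gcongr
  have bb : ∀ z, |logisticVar z| ≤ 1/4 := fun z => by
    rw [abs_of_nonneg (logisticVar_nonneg z)]; exact logisticVar_le z
  have key := matrix_psd h (by fun_prop) (|1 - c * min ε 1| * (1/4) + 1/4) (fun t => by
      refine (abs_sub _ _).trans ?_
      rw [abs_mul]
      gcongr <;> apply bb) θ (by linarith)
    (by
      have := one_dim M (Real.sqrt (∑ i, θ i ^ 2)) (1/c₀) (1/c₀+1) ε 1 c hε (fun _ => 1)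
        (by fun_prop) (by simp) (by simp) (by simp) (by simp) (by simp) hr c0.le (by
          rw [hcd]; gcongr; exact min_le_left _ _)
      simpa [hh] using this)
    (by
      refine one_dim M (Real.sqrt (∑ i, θ i ^ 2)) (1/c₀) (1/c₀+1) ε ((1/c₀)^2) c hε (fun g => g^2)
        (by fun_prop) (fun g => sq_nonneg g) ?_ ?_ (by positivity) ?_ hr c0.le (by
          rw [hcd]; gcongr; exact min_le_right _ _)
      · exact (memLp_id_gaussianReal 2).integrable_sq
      · have := variance_id_gaussianReal (μ := 0) (v := 1)
        rw [variance_of_integral_eq_zero aemeasurable_id (by simp)] at this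
        simpa using this.le
      · rintro g ⟨g1, g2⟩
        have : 0 < 1/c₀ := by positivity
        gcongr)
  have hint : ∀ (i j : Fin d) (b : ℝ), Integrable (fun x : Fin d → ℝ =>
      logisticVar (b * ∑ l, x l * θ l) * x i * x j) (Measure.pi fun _ => gaussianReal 0 1) := by
    intro i j b
    simp_rw [mul_assoc]
    refine Integrable.bdd_mul (c := 1/4)
      ((gl_coord i).memLp_two.integrable_mul (gl_coord j).memLp_two) ?_ (ae_of_all _ fun x => bb _)
    have : Continuous fun x : Fin d → ℝ => logisticVar (b * ∑ l, x l * θ l) := by fun_prop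
    exact this.aestronglyMeasurable
  convert key using 1
  ext i j
  simp only [Matrix.sub_apply, Matrix.smul_apply, Matrix.of_apply, smul_eq_mul, hh, _root_.stdGaussian]
  rw [← integral_const_mul, ← integral_sub]
  · congr 1; ext x; ring
  · simpa using (hint i j 1).const_mul (1 - c * min ε 1)
  · exact hint i j (1 + ε)
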